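/- SDP representation of the worst-case CVaR of a quadratic loss (Lemma 1): Let ε ∈ (0,1), μ ∈ ℝ^n, and Σ ∈ ℝ^{n×n} symmetric positive definite, and let L(ξ) = ξᵀ P ξ + 2 qᵀ ξ + r with P ∈ ℝ^{n×n} symmetric, q ∈ ℝ^n, r ∈ ℝ. Let Ω ∈ ℝ^{(n+1)×(n+1)} be the block matrix Ω = [[Σ + μμᵀ, μ],[μᵀ, 1]]. Then sup_{P ∈ 𝒫(μ,Σ)} CVaR_ε^P[L] equals the infimum, over all β ∈ ℝ and all symmetric matrices N ∈ ℝ^{(n+1)×(n+1)} satisfying N ⪰ 0 and N − [[P, q],[qᵀ, r − β]] ⪰ 0, of β + (1/ε)·Tr(Ω N). -/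

import Mathlib

open MeasureTheory Matrix

/-- Conditional value-at-risk of a loss `L` at level `ε` with respect to `P`. -/
noncomputable def CVaR {n : ℕ} (ε : ℝ) (P : Measure (Fin n → ℝ)) (L : (Fin n → ℝ) → ℝ) : ℝ :=
  ⨅ β : ℝ, (β + (1 / ε) * ∫ ξ, max (L ξ - β) 0 ∂P)

/-- The set `𝒫(μ,Σ)` of Borel probability measures on `ℝ^n` with finite second moments,
mean `μ`, and covariance matrix `Σ`. -/
def PsetMu (n : ℕ) (μ : Fin n → ℝ) (S : Matrix (Fin n) (Fin n) ℝ) :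
    Set (Measure (Fin n → ℝ)) :=
  {P | IsProbabilityMeasure P ∧ Integrable (fun ξ => ‖ξ‖ ^ 2) P ∧
    (∀ i, ∫ ξ, ξ i ∂P = μ i) ∧ ∀ i j, ∫ ξ, (ξ i - μ i) * (ξ j - μ j) ∂P = S i j}

/-- The second-order moment matrix `Ω = [[Σ + μμᵀ, μ],[μᵀ, 1]]`. -/
def OmegaMat {n : ℕ} (μ : Fin n → ℝ) (S : Matrix (Fin n) (Fin n) ℝ) :
    Matrix (Fin n ⊕ Unit) (Fin n ⊕ Unit) ℝ :=
  Matrix.fromBlocks (S + Matrix.of fun i j => μ i * μ j)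
    (Matrix.of fun i _ => μ i) (Matrix.of fun _ j => μ j) (Matrix.of fun _ _ => (1 : ℝ))

/-- The block matrix `[[P, q],[qᵀ, ρ]]`. -/
def Qblock {n : ℕ} (P : Matrix (Fin n) (Fin n) ℝ) (q : Fin n → ℝ) (ρ : ℝ) :
    Matrix (Fin n ⊕ Unit) (Fin n ⊕ Unit) ℝ :=
  Matrix.fromBlocks P (Matrix.of fun i _ => q i) (Matrix.of fun _ j => q j)
    (Matrix.of fun _ _ => ρ)

namespace Matrix

variable {ι : Type*} [Fintype ι] [DecidableEq ι]

open scoped MatrixOrder Norms.L2Operator in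
theorem PosSemidef.exists_transpose_mul_self {A : Matrix ι ι ℝ} (hA : A.PosSemidef) :
    ∃ C : Matrix ι ι ℝ, A = Cᵀ * C := by
  obtain ⟨C, hC⟩ := CStarAlgebra.nonneg_iff_eq_star_mul_self.mp hA.nonneg
  exact ⟨C, by rw [hC, star_eq_conjTranspose, conjTranspose_eq_transpose_of_trivial]⟩

theorem PosDef.exists_isUnit_transpose_mul_self {A : Matrix ι ι ℝ} (hA : A.PosDef) :
    ∃ C : Matrix ι ι ℝ, IsUnit C.det ∧ A = Cᵀ * C := by
  obtain ⟨C, rfl⟩ := hA.posSemidef.exists_transpose_mul_self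
  refine ⟨C, ?_, rfl⟩
  have h := hA.det_pos
  rw [det_mul, det_transpose] at h
  exact isUnit_iff_ne_zero.mpr fun h0 => by simp [h0] at h

theorem IsHermitian.exists_isUnit_simultaneous_diagonal {M B : Matrix ι ι ℝ}
    (hM : M.IsHermitian) (hB : IsUnit B.det) :
    ∃ (C : Matrix ι ι ℝ) (d : ι → ℝ), IsUnit C.det ∧ Bᵀ * B = Cᵀ * C ∧
      C * M * Cᵀ = diagonal d := by
  have hM' : (B * M * Bᵀ).IsHermitian := by
    simpa using isHermitian_mul_mul_conjTranspose B hM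
  have hs := hM'.spectral_theorem
  rw [Unitary.conjStarAlgAut_apply] at hs
  set U : Matrix ι ι ℝ := hM'.eigenvectorUnitary.1
  set d := hM'.eigenvalues
  have h1 : Uᵀ * U = 1 := by
    simpa [star_eq_conjTranspose] using Unitary.coe_star_mul_self hM'.eigenvectorUnitary
  have h2 : U * Uᵀ = 1 := mul_eq_one_comm.mp h1
  rw [star_eq_conjTranspose, conjTranspose_eq_transpose_of_trivial] at hs
  replace hs : B * M * Bᵀ = U * diagonal d * Uᵀ := hs
  refine ⟨Uᵀ * B, d, ?_, ?_, ?_⟩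
  · rw [det_mul]
    exact (IsUnit.of_mul_eq_one _ (by rw [← det_mul, h1, det_one])).mul hB
  · rw [transpose_mul, transpose_transpose, Matrix.mul_assoc, ← Matrix.mul_assoc U, h2,
      Matrix.one_mul]
  · calc Uᵀ * B * M * (Uᵀ * B)ᵀ = Uᵀ * (B * M * Bᵀ) * U := by
          simp only [transpose_mul, transpose_transpose, Matrix.mul_assoc]
      _ = (Uᵀ * U) * diagonal d * (Uᵀ * U) := by
          rw [hs]; simp only [Matrix.mul_assoc]
      _ = diagonal d := by
          rw [h1, Matrix.one_mul, Matrix.mul_one]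

/-- Strong duality between `max {Tr(A M) : 0 ⪯ A ⪯ BᵀB}` and
`min {Tr(BᵀB N) : N ⪰ 0, N ⪰ M}`. -/
theorem IsHermitian.exists_posSemidef_trace_eq {M B : Matrix ι ι ℝ}
    (hM : M.IsHermitian) (hB : IsUnit B.det) :
    ∃ A N : Matrix ι ι ℝ, A.PosSemidef ∧ (Bᵀ * B - A).PosSemidef ∧ N.PosSemidef ∧
      (N - M).PosSemidef ∧ (Bᵀ * B * N).trace = (A * M).trace := by
  obtain ⟨C, d, hC, hBC, hd⟩ := hM.exists_isUnit_simultaneous_diagonal hB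
  have hCi : C⁻¹ * C = 1 := nonsing_inv_mul C hC
  have hCi' : C * C⁻¹ = 1 := mul_nonsing_inv C hC
  have hCt : Cᵀ * (C⁻¹)ᵀ = 1 := by rw [← transpose_mul, hCi, transpose_one]
  have hMd : M = C⁻¹ * diagonal d * (C⁻¹)ᵀ := by
    rw [← hd]
    calc M = (C⁻¹ * C) * M * (Cᵀ * (C⁻¹)ᵀ) := by simp [hCi, hCt]
      _ = _ := by simp only [Matrix.mul_assoc]
  let e : ι → ℝ := fun i => if 0 < d i then 1 else 0
  refine ⟨Cᵀ * diagonal e * C, C⁻¹ * diagonal (fun i => max (d i) 0) * (C⁻¹)ᵀ, ?_, ?_, ?_, ?_, ?_⟩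
  · simpa using (PosSemidef.diagonal (d := e)
      (fun i => by simp only [e, Pi.zero_apply]; split_ifs <;> simp)).conjTranspose_mul_mul_same C
  · have h : Bᵀ * B - Cᵀ * diagonal e * C = Cᵀ * diagonal (fun i => 1 - e i) * C := by
      rw [hBC, ← diagonal_sub, diagonal_one]
      simp [Matrix.mul_sub, Matrix.sub_mul]
    rw [h]
    simpa using (PosSemidef.diagonal (d := fun i => 1 - e i)
      (fun i => by simp only [e, Pi.zero_apply]; split_ifs <;> simp)).conjTranspose_mul_mul_same C
  · simpa using (PosSemidef.diagonal (d := fun i => max (d i) 0)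
      (fun i => le_max_right _ _)).mul_mul_conjTranspose_same C⁻¹
  · have h : C⁻¹ * diagonal (fun i => max (d i) 0) * (C⁻¹)ᵀ - M =
        C⁻¹ * diagonal (fun i => max (d i) 0 - d i) * (C⁻¹)ᵀ := by
      conv_lhs => rw [hMd]
      rw [← diagonal_sub, Matrix.mul_sub, Matrix.sub_mul]
    rw [h]
    simpa using (PosSemidef.diagonal (d := fun i => max (d i) 0 - d i)
      (fun i => sub_nonneg.mpr (le_max_left _ _))).mul_mul_conjTranspose_same C⁻¹
  · have h1 : Bᵀ * B * (C⁻¹ * diagonal (fun i => max (d i) 0) * (C⁻¹)ᵀ) =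
        Cᵀ * (diagonal (fun i => max (d i) 0) * (C⁻¹)ᵀ) := by
      rw [hBC]
      calc _ = Cᵀ * (C * C⁻¹) * (diagonal (fun i => max (d i) 0) * (C⁻¹)ᵀ) := by
            simp only [Matrix.mul_assoc]
        _ = _ := by rw [hCi', Matrix.mul_one]
    have hCt' : (C⁻¹)ᵀ * Cᵀ = 1 := mul_eq_one_comm.mp hCt
    have h2 : Cᵀ * diagonal e * C * M = Cᵀ * (diagonal e * (C * M)) := by
      simp only [Matrix.mul_assoc]
    rw [h1, h2, trace_mul_comm, trace_mul_comm Cᵀ, Matrix.mul_assoc, Matrix.mul_assoc, hCt', hd,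
      Matrix.mul_one, diagonal_mul_diagonal, trace_diagonal, trace_diagonal]
    refine Finset.sum_congr rfl fun i _ => ?_
    simp only [e]
    split_ifs with h
    · simp [h.le]
    · simp [not_lt.mp h]

end Matrix

/-- Lagrange multiplier for one linear constraint satisfying Slater's condition. -/
theorem exists_lagrange_multiplier {E : Type*} [AddCommGroup E] [Module ℝ E] {K : Set E}
    (hK : Convex ℝ K) (h a : E →ₗ[ℝ] ℝ) {ε V : ℝ} {x₀ x₁ : E} (hx₀ : x₀ ∈ K) (hx₁ : x₁ ∈ K)
    (h₀ : a x₀ < ε) (h₁ : ε < a x₁) (hV : ∀ x ∈ K, a x = ε → h x ≤ V) :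
    ∃ β : ℝ, ∀ x ∈ K, h x - V ≤ β * (a x - ε) := by
  have key : ∀ x ∈ K, ∀ y ∈ K, a x < ε → ε < a y →
      (h y - V) / (a y - ε) ≤ (V - h x) / (ε - a x) := by
    intro x hx y hy hax hay
    have hd : 0 < a y - a x := by linarith
    have hz := hV (((a y - ε) / (a y - a x)) • x + ((ε - a x) / (a y - a x)) • y)
      (hK hx hy (div_nonneg (by linarith) hd.le) (div_nonneg (by linarith) hd.le)
        (by field_simp; ring)) (by simp only [map_add, map_smul, smul_eq_mul]; field_simp; ring)
    simp only [map_add, map_smul, smul_eq_mul] at hz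
    rw [div_mul_eq_mul_div, div_mul_eq_mul_div, ← add_div, div_le_iff₀ hd] at hz
    rw [div_le_div_iff₀ (by linarith) (by linarith)]
    linarith
  let s : Set ℝ := {t | ∃ y ∈ K, ε < a y ∧ t = (h y - V) / (a y - ε)}
  have hub : ∀ x ∈ K, a x < ε → (V - h x) / (ε - a x) ∈ upperBounds s := by
    rintro x hx hax _ ⟨y, hy, hay, rfl⟩
    exact key x hx y hy hax hay
  refine ⟨sSup s, fun x hx => ?_⟩
  rcases lt_trichotomy (a x) ε with hax | hax | hax
  · have := csSup_le (s := s) ⟨_, x₁, hx₁, h₁, rfl⟩ (hub x hx hax)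
    rw [le_div_iff₀ (by linarith)] at this
    linarith
  · have := hV x hx hax
    rw [hax]; linarith
  · have : (h x - V) / (a x - ε) ≤ sSup s := le_csSup ⟨_, hub x₀ hx₀ h₀⟩ ⟨x, hx, hax, rfl⟩
    rwa [div_le_iff₀ (by linarith)] at this

/-- The lifted vector `(ξ, 1)`. -/
def homog {n : ℕ} (ξ : Fin n → ℝ) : Fin n ⊕ Unit → ℝ := Sum.elim ξ fun _ => 1

/-- `A` is the matrix of second moments of `(ξ, 1)` under `p`. -/
def HasMomentMatrix {n : ℕ} (p : Measure (Fin n → ℝ))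
    (A : Matrix (Fin n ⊕ Unit) (Fin n ⊕ Unit) ℝ) : Prop :=
  ∀ i j, Integrable (fun ξ => homog ξ i * homog ξ j) p ∧ ∫ ξ, homog ξ i * homog ξ j ∂p = A i j

namespace HasMomentMatrix

variable {n : ℕ} {p p' : Measure (Fin n → ℝ)} {A A' : Matrix (Fin n ⊕ Unit) (Fin n ⊕ Unit) ℝ}

theorem add (h : HasMomentMatrix p A) (h' : HasMomentMatrix p' A') :
    HasMomentMatrix (p + p') (A + A') := fun i j =>
  ⟨(h i j).1.add_measure (h' i j).1, by
    rw [integral_add_measure (h i j).1 (h' i j).1, (h i j).2, (h' i j).2, Matrix.add_apply]⟩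

theorem integrable_and_integral_quadratic (h : HasMomentMatrix p A)
    (N : Matrix (Fin n ⊕ Unit) (Fin n ⊕ Unit) ℝ) :
    Integrable (fun ξ => homog ξ ⬝ᵥ N *ᵥ homog ξ) p ∧
      ∫ ξ, homog ξ ⬝ᵥ N *ᵥ homog ξ ∂p = (A * N).trace := by
  have hN : (fun ξ => homog ξ ⬝ᵥ N *ᵥ homog ξ) =
      fun ξ : Fin n → ℝ => ∑ i, ∑ j, N i j * (homog ξ j * homog ξ i) := by
    funext ξ
    simp only [dotProduct, mulVec, Finset.mul_sum]
    exact Finset.sum_congr rfl fun i _ => Finset.sum_congr rfl fun j _ => by ring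
  have hint : ∀ i j, Integrable (fun ξ => N i j * (homog ξ j * homog ξ i)) p := fun i j =>
    (h j i).1.const_mul _
  rw [hN]
  refine ⟨integrable_finsetSum _ fun i _ => integrable_finsetSum _ fun j _ => hint i j, ?_⟩
  rw [integral_finsetSum _ fun i _ => integrable_finsetSum _ fun j _ => hint i j]
  simp only [integral_finsetSum _ fun j _ => hint _ j, integral_const_mul, (h _ _).2,
    Matrix.trace, Matrix.diag, Matrix.mul_apply]
  rw [Finset.sum_comm]
  exact Finset.sum_congr rfl fun i _ => Finset.sum_congr rfl fun j _ => mul_comm _ _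

theorem isProbabilityMeasure [IsFiniteMeasure p] (h : HasMomentMatrix p A)
    (h1 : A (Sum.inr ()) (Sum.inr ()) = 1) : IsProbabilityMeasure p := by
  have h2 := (h (Sum.inr ()) (Sum.inr ())).2
  simp only [homog, Sum.elim_inr, mul_one, integral_const, smul_eq_mul, h1] at h2
  exact ⟨by rwa [measureReal_def, ENNReal.toReal_eq_one_iff] at h2⟩

end HasMomentMatrix

theorem mem_PsetMu_iff {n : ℕ} {μ : Fin n → ℝ} {S : Matrix (Fin n) (Fin n) ℝ}
    {p : Measure (Fin n → ℝ)} :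
    p ∈ PsetMu n μ S ↔ IsProbabilityMeasure p ∧ HasMomentMatrix p (OmegaMat μ S) := by
  have hcov : ∀ (_ : IsProbabilityMeasure p) (i j : Fin n),
      Integrable (fun ξ : Fin n → ℝ => ξ i) p → Integrable (fun ξ : Fin n → ℝ => ξ j) p →
      Integrable (fun ξ : Fin n → ℝ => ξ i * ξ j) p →
      ∫ ξ, ξ i ∂p = μ i → ∫ ξ, ξ j ∂p = μ j →
      ∫ ξ, (ξ i - μ i) * (ξ j - μ j) ∂p = ∫ ξ, ξ i * ξ j ∂p - μ i * μ j := by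
    intro _ i j hi hj hij hmi hmj
    have : (fun ξ : Fin n → ℝ => (ξ i - μ i) * (ξ j - μ j)) =
        fun ξ => ξ i * ξ j - μ j * ξ i - μ i * ξ j + μ i * μ j := by
      funext ξ; ring
    have h1 : Integrable (fun ξ : Fin n → ℝ => ξ i * ξ j - μ j * ξ i) p :=
      hij.sub (hi.const_mul _)
    have h2 : Integrable (fun ξ : Fin n → ℝ => ξ i * ξ j - μ j * ξ i - μ i * ξ j) p :=
      h1.sub (hj.const_mul _)
    rw [this, integral_add h2 (integrable_const _), integral_sub h1 (hj.const_mul _),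
      integral_sub hij (hi.const_mul _), integral_const_mul, integral_const_mul, hmi, hmj]
    simp only [integral_const, probReal_univ, smul_eq_mul]
    ring
  constructor
  · rintro ⟨hp, hint, hm, hc⟩
    refine ⟨hp, ?_⟩
    have hij : ∀ i j, Integrable (fun ξ : Fin n → ℝ => ξ i * ξ j) p := fun i j =>
      hint.mono' (by fun_prop) (.of_forall fun ξ => by
        rw [norm_mul, sq]
        exact mul_le_mul (norm_le_pi_norm ξ i) (norm_le_pi_norm ξ j) (norm_nonneg _)
          (norm_nonneg _))
    have hi : ∀ i, Integrable (fun ξ : Fin n → ℝ => ξ i) p := fun i =>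
      (hint.add (integrable_const (1 : ℝ))).mono' (measurable_pi_apply i).aestronglyMeasurable (.of_forall fun ξ => by
        have := norm_le_pi_norm ξ i
        simp only [Pi.add_apply]
        nlinarith [sq_nonneg (‖ξ‖ - 1), norm_nonneg ξ])
    rintro (i | i) (j | j)
    · refine ⟨hij i j, ?_⟩
      have := hcov hp i j (hi i) (hi j) (hij i j) (hm i) (hm j)
      rw [hc] at this
      simp only [homog, Sum.elim_inl, OmegaMat, fromBlocks_apply₁₁, Matrix.add_apply, of_apply]
      linarith
    · simpa [homog, OmegaMat] using And.intro (hi i) (hm i)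
    · simpa [homog, OmegaMat] using And.intro (hi j) (hm j)
    · simp [homog, OmegaMat]
  · rintro ⟨hp, h⟩
    have hi : ∀ i, Integrable (fun ξ : Fin n → ℝ => ξ i) p := fun i => by
      simpa [homog] using (h (Sum.inl i) (Sum.inr ())).1
    have hm : ∀ i, ∫ ξ, ξ i ∂p = μ i := fun i => by
      simpa [homog, OmegaMat] using (h (Sum.inl i) (Sum.inr ())).2
    have hij : ∀ i j, Integrable (fun ξ : Fin n → ℝ => ξ i * ξ j) p := fun i j => by
      simpa [homog] using (h (Sum.inl i) (Sum.inl j)).1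
    refine ⟨hp, ?_, hm, fun i j => ?_⟩
    · refine (integrable_finsetSum Finset.univ fun i _ => hij i i).mono' (by fun_prop)
        (.of_forall fun ξ => ?_)
      rw [norm_pow, norm_norm]
      have h0 : 0 ≤ ∑ i, ξ i * ξ i := Finset.sum_nonneg fun i _ => mul_self_nonneg _
      refine (Real.le_sqrt (norm_nonneg _) h0).mp ((pi_norm_le_iff_of_nonneg
        (Real.sqrt_nonneg _)).mpr fun i => Real.le_sqrt_of_sq_le ?_)
      rw [Real.norm_eq_abs, sq_abs, sq]
      exact Finset.single_le_sum (f := fun i => ξ i * ξ i) (fun i _ => mul_self_nonneg _)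
        (Finset.mem_univ i)
    · rw [hcov hp i j (hi i) (hi j) (hij i j) (hm i) (hm j)]
      have := (h (Sum.inl i) (Sum.inl j)).2
      simp only [homog, Sum.elim_inl, OmegaMat, fromBlocks_apply₁₁, Matrix.add_apply,
        of_apply] at this
      linarith

/-- Every positive semidefinite matrix with positive corner entry is the moment matrix of a
finitely supported measure. -/
theorem Matrix.PosSemidef.exists_hasMomentMatrix {n : ℕ}
    {A : Matrix (Fin n ⊕ Unit) (Fin n ⊕ Unit) ℝ} (hA : A.PosSemidef)
    (hc : 0 < A (Sum.inr ()) (Sum.inr ())) :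
    ∃ p : Measure (Fin n → ℝ), IsFiniteMeasure p ∧ HasMomentMatrix p A := by
  obtain ⟨C, rfl⟩ := hA.exists_transpose_mul_self
  set c : ℝ := (Cᵀ * C) (Sum.inr ()) (Sum.inr ()) with hcdef
  let K : ℝ := Fintype.card (Fin n ⊕ Unit)
  have hK : 0 < K := Nat.cast_pos.mpr Fintype.card_pos
  let w : ℝ := c / (2 * K)
  have hw : 0 < w := by positivity
  let a : ℝ := √(1 / (2 * w))
  have ha : 2 * w * (a * a) = 1 := by
    rw [Real.mul_self_sqrt (by positivity)]; field_simp
  have hwK : K * (2 * w) = c := by simp only [w]; field_simp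
  let m : Fin n → ℝ := fun i => (Cᵀ * C) (Sum.inl i) (Sum.inr ()) / c
  let L : Fin n ⊕ Unit → Fin n → ℝ := fun k i => C k (Sum.inl i) - m i * C k (Sum.inr ())
  have hsymm : ∀ i j, (Cᵀ * C) i j = (Cᵀ * C) j i := fun i j => by
    simp only [Matrix.mul_apply, transpose_apply, mul_comm]
  have hm : ∀ i, (Cᵀ * C) (Sum.inl i) (Sum.inr ()) = c * m i := fun i => by
    simp only [m]; field_simp
  have hL : ∀ i j, ∑ k, L k i * L k j = (Cᵀ * C) (Sum.inl i) (Sum.inl j) - c * m i * m j := by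
    intro i j
    have h1 : ∑ k, L k i * L k j = (Cᵀ * C) (Sum.inl i) (Sum.inl j)
        - m j * (Cᵀ * C) (Sum.inl i) (Sum.inr ()) - m i * (Cᵀ * C) (Sum.inl j) (Sum.inr ())
        + m i * m j * c := by
      simp only [hcdef, Matrix.mul_apply, transpose_apply, Finset.mul_sum,
        ← Finset.sum_sub_distrib, ← Finset.sum_add_distrib]
      exact Finset.sum_congr rfl fun k _ => by simp only [L]; ring
    rw [h1, hm, hm]; ring
  let p : Measure (Fin n → ℝ) := ∑ k, ENNReal.ofReal w •
    (Measure.dirac (m + a • L k) + Measure.dirac (m - a • L k))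
  have hint0 : ∀ (f : (Fin n → ℝ) → ℝ) k, Integrable f (ENNReal.ofReal w •
      (Measure.dirac (m + a • L k) + Measure.dirac (m - a • L k))) := fun f k =>
    ((integrable_dirac (by simp)).add_measure (integrable_dirac (by simp))).smul_measure
      ENNReal.ofReal_ne_top
  have hint : ∀ f : (Fin n → ℝ) → ℝ, Integrable f p := fun f =>
    integrable_finsetSum_measure.mpr fun k _ => hint0 f k
  have hval : ∀ f : (Fin n → ℝ) → ℝ,
      ∫ ξ, f ξ ∂p = ∑ k, w * (f (m + a • L k) + f (m - a • L k)) := fun f => by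
    rw [integral_finsetSum_measure fun k _ => hint0 f k]
    refine Finset.sum_congr rfl fun k _ => ?_
    rw [integral_smul_measure, integral_add_measure (integrable_dirac (by simp))
      (integrable_dirac (by simp)), integral_dirac, integral_dirac,
      ENNReal.toReal_ofReal hw.le, smul_eq_mul]
  refine ⟨p, ?_, fun i j => ⟨hint _, ?_⟩⟩
  · exact ⟨(integrable_const_iff_isFiniteMeasure one_ne_zero).mp (hint fun _ => 1) |>.1⟩
  · rw [hval]
    rcases i with i | i <;> rcases j with j | j
    · have h2 : ∀ k, w * (homog (m + a • L k) (Sum.inl i) * homog (m + a • L k) (Sum.inl j) +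
          homog (m - a • L k) (Sum.inl i) * homog (m - a • L k) (Sum.inl j)) =
          2 * w * (m i * m j) + L k i * L k j := fun k => by
        simp only [homog, Sum.elim_inl, Pi.add_apply, Pi.sub_apply, Pi.smul_apply, smul_eq_mul]
        linear_combination (L k i * L k j) * ha
      simp only [h2, Finset.sum_add_distrib, hL, Finset.sum_const, Finset.card_univ, nsmul_eq_mul]
      linear_combination (m i * m j) * hwK
    · have h2 : ∀ k, w * (homog (m + a • L k) (Sum.inl i) * homog (m + a • L k) (Sum.inr j) +
          homog (m - a • L k) (Sum.inl i) * homog (m - a • L k) (Sum.inr j)) =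
          2 * w * m i := fun k => by
        simp only [homog, Sum.elim_inl, Sum.elim_inr, Pi.add_apply, Pi.sub_apply, Pi.smul_apply,
          smul_eq_mul]
        ring
      simp only [h2, Finset.sum_const, Finset.card_univ, nsmul_eq_mul, hm]
      linear_combination (m i) * hwK
    · have h2 : ∀ k, w * (homog (m + a • L k) (Sum.inr i) * homog (m + a • L k) (Sum.inl j) +
          homog (m - a • L k) (Sum.inr i) * homog (m - a • L k) (Sum.inl j)) =
          2 * w * m j := fun k => by
        simp only [homog, Sum.elim_inl, Sum.elim_inr, Pi.add_apply, Pi.sub_apply, Pi.smul_apply,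
          smul_eq_mul]
        ring
      simp only [h2, Finset.sum_const, Finset.card_univ, nsmul_eq_mul]
      rw [hsymm, hm]
      linear_combination (m j) * hwK
    · simp only [homog, Sum.elim_inr, Finset.sum_const, Finset.card_univ, nsmul_eq_mul]
      linear_combination hwK

theorem trace_mul_Qblock_sub {n : ℕ} (A : Matrix (Fin n ⊕ Unit) (Fin n ⊕ Unit) ℝ)
    (P : Matrix (Fin n) (Fin n) ℝ) (q : Fin n → ℝ) (r β : ℝ) :
    (A * Qblock P q (r - β)).trace =
      (A * Qblock P q r).trace - β * A (Sum.inr ()) (Sum.inr ()) := by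
  simp only [Qblock, Matrix.trace, Matrix.diag, Matrix.mul_apply, Fintype.sum_sum_type,
    fromBlocks_apply₁₁, fromBlocks_apply₁₂, fromBlocks_apply₂₁, fromBlocks_apply₂₂, of_apply,
    Finset.univ_unique, Finset.sum_singleton, PUnit.default_eq_unit]
  ring

theorem homog_dotProduct_Qblock_mulVec {n : ℕ} (P : Matrix (Fin n) (Fin n) ℝ) (q : Fin n → ℝ)
    (ρ : ℝ) (ξ : Fin n → ℝ) :
    homog ξ ⬝ᵥ Qblock P q ρ *ᵥ homog ξ = ξ ⬝ᵥ P *ᵥ ξ + 2 * (q ⬝ᵥ ξ) + ρ := by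
  have h : Qblock P q ρ *ᵥ homog ξ = Sum.elim (P *ᵥ ξ + q) fun _ => q ⬝ᵥ ξ + ρ := by
    funext i
    rcases i with i | i <;> simp [Qblock, homog, mulVec, dotProduct]
  rw [h, homog, sumElim_dotProduct_sumElim, dotProduct_add, dotProduct_comm ξ q]
  simp [dotProduct]
  ring

theorem Qblock_isHermitian {n : ℕ} {P : Matrix (Fin n) (Fin n) ℝ} (hP : P.IsSymm)
    (q : Fin n → ℝ) (ρ : ℝ) : (Qblock P q ρ).IsHermitian := by
  ext i j
  rcases i with i | i <;> rcases j with j | j <;>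
    simp [Qblock, Matrix.conjTranspose_apply, hP.apply]

theorem OmegaMat_eq_transpose_mul_self {n : ℕ} (μ : Fin n → ℝ) {S : Matrix (Fin n) (Fin n) ℝ}
    (hS : S.PosDef) : ∃ B : Matrix (Fin n ⊕ Unit) (Fin n ⊕ Unit) ℝ,
      IsUnit B.det ∧ OmegaMat μ S = Bᵀ * B := by
  obtain ⟨C, hC, rfl⟩ := hS.exists_isUnit_transpose_mul_self
  refine ⟨fromBlocks C 0 (Matrix.of fun _ j => μ j) 1, ?_, ?_⟩
  · simpa [det_fromBlocks_zero₁₂] using hC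
  · rw [fromBlocks_transpose, fromBlocks_multiply, OmegaMat]
    congr 1 <;> ext i j <;> simp [Matrix.mul_apply]

theorem CVaR_le {n : ℕ} {ε : ℝ} (hε : ε ∈ Set.Ioo (0 : ℝ) 1) {p : Measure (Fin n → ℝ)}
    [IsProbabilityMeasure p] {L : (Fin n → ℝ) → ℝ} (hL : Integrable L p) (β : ℝ) :
    CVaR ε p L ≤ β + (1 / ε) * ∫ ξ, max (L ξ - β) 0 ∂p := by
  refine ciInf_le ⟨∫ ξ, L ξ ∂p, ?_⟩ β
  rintro _ ⟨b, rfl⟩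
  have hb : Integrable (fun ξ => L ξ - b) p := hL.sub (integrable_const b)
  have h1 : ∫ ξ, L ξ - b ∂p ≤ ∫ ξ, max (L ξ - b) 0 ∂p :=
    integral_mono hb hb.pos_part fun ξ => le_max_left _ _
  have h2 : 0 ≤ ∫ ξ, max (L ξ - b) 0 ∂p := integral_nonneg fun ξ => le_max_right _ _
  have h3 : 1 ≤ 1 / ε := (one_le_div hε.1).mpr hε.2.le
  rw [integral_sub hL (integrable_const b), integral_const, probReal_univ, one_smul] at h1
  have := le_mul_of_one_le_left h2 h3
  dsimp only
  linarith

theorem le_CVaR_add {n : ℕ} {ε : ℝ} (hε : 0 < ε) {p₁ p₂ : Measure (Fin n → ℝ)}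
    [IsFiniteMeasure p₁] [IsFiniteMeasure p₂] (hp : p₁.real Set.univ = ε)
    {L : (Fin n → ℝ) → ℝ} (hL₁ : Integrable L p₁) (hL₂ : Integrable L p₂) :
    (1 / ε) * ∫ ξ, L ξ ∂p₁ ≤ CVaR ε (p₁ + p₂) L := by
  refine le_ciInf fun β => ?_
  have hb₁ : Integrable (fun ξ => L ξ - β) p₁ := hL₁.sub (integrable_const β)
  have hb₂ : Integrable (fun ξ => L ξ - β) p₂ := hL₂.sub (integrable_const β)
  rw [integral_add_measure hb₁.pos_part hb₂.pos_part]
  have h1 : ∫ ξ, L ξ - β ∂p₁ ≤ ∫ ξ, max (L ξ - β) 0 ∂p₁ :=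
    integral_mono hb₁ hb₁.pos_part fun ξ => le_max_left _ _
  have h2 : 0 ≤ ∫ ξ, max (L ξ - β) 0 ∂p₂ := integral_nonneg fun ξ => le_max_right _ _
  rw [integral_sub hL₁ (integrable_const β), integral_const, hp, smul_eq_mul] at h1
  have h3 : ∫ ξ, L ξ ∂p₁ ≤ ε * β + (∫ ξ, max (L ξ - β) 0 ∂p₁ + ∫ ξ, max (L ξ - β) 0 ∂p₂) := by
    linarith
  calc (1 / ε) * ∫ ξ, L ξ ∂p₁
      ≤ (1 / ε) * (ε * β + (∫ ξ, max (L ξ - β) 0 ∂p₁ + ∫ ξ, max (L ξ - β) 0 ∂p₂)) :=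
        mul_le_mul_of_nonneg_left h3 (by positivity)
    _ = _ := by rw [mul_add]; field_simp

theorem HasMomentMatrix.integrable_and_integral_loss {n : ℕ} {p : Measure (Fin n → ℝ)}
    {A : Matrix (Fin n ⊕ Unit) (Fin n ⊕ Unit) ℝ} (h : HasMomentMatrix p A)
    (P : Matrix (Fin n) (Fin n) ℝ) (q : Fin n → ℝ) (r : ℝ) :
    Integrable (fun ξ => ξ ⬝ᵥ P *ᵥ ξ + 2 * (q ⬝ᵥ ξ) + r) p ∧
      ∫ ξ, (ξ ⬝ᵥ P *ᵥ ξ + 2 * (q ⬝ᵥ ξ) + r) ∂p = (A * Qblock P q r).trace := by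
  simpa only [homog_dotProduct_Qblock_mulVec] using
    h.integrable_and_integral_quadratic (Qblock P q r)

/-- Weak duality: every feasible `(β, N)` bounds the CVaR under every `p ∈ 𝒫(μ,Σ)`. -/
theorem CVaR_le_of_posSemidef {n : ℕ} {ε : ℝ} (hε : ε ∈ Set.Ioo (0 : ℝ) 1) {μ : Fin n → ℝ}
    {S : Matrix (Fin n) (Fin n) ℝ} (P : Matrix (Fin n) (Fin n) ℝ) (q : Fin n → ℝ) (r : ℝ)
    {p : Measure (Fin n → ℝ)} (hp : p ∈ PsetMu n μ S) {β : ℝ}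
    {N : Matrix (Fin n ⊕ Unit) (Fin n ⊕ Unit) ℝ} (hN : N.PosSemidef)
    (hNQ : (N - Qblock P q (r - β)).PosSemidef) :
    CVaR ε p (fun ξ => ξ ⬝ᵥ P *ᵥ ξ + 2 * (q ⬝ᵥ ξ) + r) ≤
      β + (1 / ε) * (OmegaMat μ S * N).trace := by
  obtain ⟨_, hmom⟩ := mem_PsetMu_iff.mp hp
  have hL := (hmom.integrable_and_integral_loss P q r).1
  obtain ⟨hNi, hNv⟩ := hmom.integrable_and_integral_quadratic N
  refine (CVaR_le hε hL β).trans ?_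
  have hpos : Integrable (fun ξ => max (ξ ⬝ᵥ P *ᵥ ξ + 2 * (q ⬝ᵥ ξ) + r - β) 0) p :=
    (hL.sub (integrable_const β)).pos_part
  rw [← hNv]
  refine add_le_add_right (mul_le_mul_of_nonneg_left (integral_mono hpos hNi fun ξ => ?_)
    (one_div_nonneg.mpr hε.1.le)) β
  refine max_le ?_ (by simpa using hN.dotProduct_mulVec_nonneg (homog ξ))
  have h := hNQ.dotProduct_mulVec_nonneg (homog ξ)
  rw [star_trivial, Matrix.sub_mulVec, dotProduct_sub, homog_dotProduct_Qblock_mulVec] at h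
  linarith

/-- Strong duality: every uniform bound on the CVaR over `𝒫(μ,Σ)` is certified by a feasible
`(β, N)`. -/
theorem exists_posSemidef_of_CVaR_le {n : ℕ} {ε : ℝ} (hε : ε ∈ Set.Ioo (0 : ℝ) 1)
    {μ : Fin n → ℝ} {S : Matrix (Fin n) (Fin n) ℝ} (hS : S.PosDef)
    {P : Matrix (Fin n) (Fin n) ℝ} (hP : P.IsSymm) (q : Fin n → ℝ) (r : ℝ) {t : ℝ}
    (ht : ∀ p ∈ PsetMu n μ S, CVaR ε p (fun ξ => ξ ⬝ᵥ P *ᵥ ξ + 2 * (q ⬝ᵥ ξ) + r) ≤ t) :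
    ∃ (β : ℝ) (N : Matrix (Fin n ⊕ Unit) (Fin n ⊕ Unit) ℝ), N.PosSemidef ∧
      (N - Qblock P q (r - β)).PosSemidef ∧ β + (1 / ε) * (OmegaMat μ S * N).trace ≤ t := by
  obtain ⟨B, hB, hΩ⟩ := OmegaMat_eq_transpose_mul_self μ hS
  have hΩp : (OmegaMat μ S).PosSemidef := by
    rw [hΩ]; simpa using posSemidef_conjTranspose_mul_self B
  have hΩ1 : OmegaMat μ S (Sum.inr ()) (Sum.inr ()) = 1 := rfl
  let K : Set (Matrix (Fin n ⊕ Unit) (Fin n ⊕ Unit) ℝ) :=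
    {A | A.PosSemidef ∧ (OmegaMat μ S - A).PosSemidef}
  have hK : Convex ℝ K := by
    intro A hA A' hA' x y hx hy hxy
    refine ⟨(hA.1.smul hx).add (hA'.1.smul hy), ?_⟩
    have h : OmegaMat μ S - (x • A + y • A') =
        x • (OmegaMat μ S - A) + y • (OmegaMat μ S - A') := by
      calc _ = (x + y) • OmegaMat μ S - (x • A + y • A') := by rw [hxy, one_smul]
        _ = _ := by module
    rw [h]
    exact (hA.2.smul hx).add (hA'.2.smul hy)
  have hV : ∀ A ∈ K, A (Sum.inr ()) (Sum.inr ()) = ε → (A * Qblock P q r).trace ≤ ε * t := by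
    intro A hA hAε
    obtain ⟨p₁, _, h₁⟩ := hA.1.exists_hasMomentMatrix (hAε ▸ hε.1)
    obtain ⟨p₂, _, h₂⟩ := hA.2.exists_hasMomentMatrix (by
      rw [Matrix.sub_apply, hΩ1, hAε]; exact sub_pos.mpr hε.2)
    have h := h₁.add h₂
    rw [add_sub_cancel] at h
    have hm : p₁.real Set.univ = ε := by
      simpa [homog, hAε] using (h₁ (Sum.inr ()) (Sum.inr ())).2
    have h3 := (le_CVaR_add hε.1 hm (h₁.integrable_and_integral_loss P q r).1
      (h₂.integrable_and_integral_loss P q r).1).trans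
      (ht _ (mem_PsetMu_iff.mpr ⟨h.isProbabilityMeasure hΩ1, h⟩))
    rwa [(h₁.integrable_and_integral_loss P q r).2, one_div, inv_mul_le_iff₀ hε.1] at h3
  obtain ⟨β, hβ⟩ := exists_lagrange_multiplier hK
    ((Matrix.traceLinearMap _ ℝ ℝ).comp (LinearMap.mulRight ℝ (Qblock P q r)))
    (Matrix.entryLinearMap ℝ ℝ (Sum.inr ()) (Sum.inr ())) (ε := ε) (V := ε * t) (x₀ := 0)
    (x₁ := OmegaMat μ S) ⟨.zero, by simpa using hΩp⟩ ⟨hΩp, by simpa using PosSemidef.zero⟩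
    (by simpa using hε.1) (by simpa [hΩ1] using hε.2) (by simpa using hV)
  obtain ⟨A, N, hA, hA', hN, hNQ, htr⟩ :=
    (Qblock_isHermitian hP q (r - β)).exists_posSemidef_trace_eq hB
  rw [← hΩ] at hA' htr
  refine ⟨β, N, hN, hNQ, ?_⟩
  have h := hβ A ⟨hA, hA'⟩
  simp only [LinearMap.comp_apply, LinearMap.mulRight_apply, Matrix.traceLinearMap_apply,
    Matrix.entryLinearMap_apply] at h
  rw [htr, trace_mul_Qblock_sub]
  have h4 : (1 / ε) * ((A * Qblock P q r).trace - β * A (Sum.inr ()) (Sum.inr ())) ≤ t - β := by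
    rw [one_div, inv_mul_le_iff₀ hε.1]
    linarith
  linarith

/-- SDP representation of the worst-case CVaR of a quadratic loss (Lemma 1). -/
theorem wcvar_quadratic_sdp {n : ℕ} (ε : ℝ) (hε : ε ∈ Set.Ioo (0 : ℝ) 1)
    (μ : Fin n → ℝ) (S : Matrix (Fin n) (Fin n) ℝ) (hS : S.PosDef)
    (P : Matrix (Fin n) (Fin n) ℝ) (hP : P.IsSymm) (q : Fin n → ℝ) (r : ℝ) :
    (⨆ p ∈ PsetMu n μ S,
        ((CVaR ε p (fun ξ => ξ ⬝ᵥ P.mulVec ξ + 2 * (q ⬝ᵥ ξ) + r) : ℝ) : EReal)) =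
      ⨅ (β : ℝ) (N : Matrix (Fin n ⊕ Unit) (Fin n ⊕ Unit) ℝ)
        (_ : N.PosSemidef) (_ : (N - Qblock P q (r - β)).PosSemidef),
        ((β + (1 / ε) * (OmegaMat μ S * N).trace : ℝ) : EReal) := by
  apply le_antisymm
  · refine iSup₂_le fun p hp => le_iInf fun β => le_iInf fun N => le_iInf fun hN =>
      le_iInf fun hNQ => ?_
    exact EReal.coe_le_coe_iff.mpr (CVaR_le_of_posSemidef hε P q r hp hN hNQ)
  · refine EReal.le_of_forall_lt_iff_le.mp fun t ht => ?_
    obtain ⟨β, N, hN, hNQ, h⟩ := exists_posSemidef_of_CVaR_le hε hS hP q r (t := t) fun p hp =>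
      EReal.coe_le_coe_iff.mp ((le_iSup₂_of_le p hp le_rfl).trans ht.le)
    exact iInf_le_of_le β <| iInf_le_of_le N <| iInf_le_of_le hN <| iInf_le_of_le hNQ <|
      EReal.coe_le_coe_iff.mpr h
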